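/- Let n, m ∈ ℕ with 0 ≤ m ≤ n, and let q, t1, t2, t4, u ∈ ℂ with q ≠ 0, t1 ≠ 0, t2 ≠ 0, t4 ≠ 0, u ≠ 0. Set t3 = q^{1−m}/t4. Assume (q;q)_k ≠ 0, (t1t2;q)_k ≠ 0, (t1t4;q)_k ≠ 0, and (q^{1−m}t1/t4;q)_k ≠ 0 for all k ≤ n, and assume (t2t1;q)_k ≠ 0, (t2 q/t4;q)_k ≠ 0, and (q^m t2 t4;q)_k ≠ 0 for all k ≤ n−m (so that both Askey–Wilson polynomials below are defined). Then the following partial factorization holds: (t1t2;q)_{n−m} · p_n(u; t1, t2, q^{1−m}/t4, t4 | q) = (−1)^m · t4^{−m} · q^{−C(m,2)} · (t4 u;q)_m · (t4/u;q)_m · (t1t2;q)_n · p_{n−m}(u; t2, t1, q/t4, q^m t4 | q), where C(m,2) = m(m−1)/2. -/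

import Mathlib

open Finset

/-- q-shifted factorial `(a;q)_k = ∏_{j=0}^{k-1} (1 - a q^j)`. -/
noncomputable def qpoch (a q : ℂ) (k : ℕ) : ℂ := ∏ i ∈ Finset.range k, (1 - a * q ^ i)

/-- The Askey–Wilson polynomial `p_n(u; t1,t2,t3,t4 | q)` in the variable `u`
(`u` plays the role of `e^{iθ}`, so `x = (u + 1/u)/2 = cos θ`). -/
noncomputable def askeyWilson (q : ℂ) (n : ℕ) (u t1 t2 t3 t4 : ℂ) : ℂ :=
  t1 ^ (-(n : ℤ)) * qpoch (t1 * t2) q n * qpoch (t1 * t3) q n * qpoch (t1 * t4) q n *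
    ∑ k ∈ Finset.range (n + 1),
      (qpoch (q ^ (-(n : ℤ))) q k * qpoch (t1 * t2 * t3 * t4 * q ^ ((n : ℤ) - 1)) q k *
        qpoch (t1 * u) q k * qpoch (t1 / u) q k * q ^ k) /
      (qpoch q q k * qpoch (t1 * t2) q k * qpoch (t1 * t3) q k * qpoch (t1 * t4) q k)

theorem qpoch_zero (a q : ℂ) : qpoch a q 0 = 1 := by simp [qpoch]

theorem qpoch_succ (a q : ℂ) (k : ℕ) : qpoch a q (k + 1) = qpoch a q k * (1 - a * q ^ k) := by
  simp [qpoch, prod_range_succ]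

theorem qpoch_add (a q : ℂ) (k l : ℕ) :
    qpoch a q (k + l) = qpoch a q k * qpoch (a * q ^ k) q l := by
  simp only [qpoch, prod_range_add]
  congr 1
  exact prod_congr rfl fun i _ => by ring

theorem qpoch_succ' (a q : ℂ) (k : ℕ) :
    qpoch a q (k + 1) = (1 - a) * qpoch (a * q) q k := by
  rw [add_comm, qpoch_add]
  simp [qpoch]

theorem qpoch_eq_zero {a q : ℂ} {i k : ℕ} (hi : i < k) (h : a * q ^ i = 1) :
    qpoch a q k = 0 :=
  prod_eq_zero (mem_range.mpr hi) (by rw [h, sub_self])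

/-- The part of the `k`-th coefficient of an Askey–Wilson polynomial that depends on the
parameters only through their product `e`. -/
noncomputable def awCoeff (q : ℂ) (n : ℕ) (e : ℂ) (k : ℕ) : ℂ :=
  qpoch (q ^ n)⁻¹ q k * qpoch (e * q ^ n / q) q k * q ^ k / qpoch q q k

/-- The Askey–Wilson sum with denominators `(ab;q)_k (ac;q)_k (ad;q)_k` cleared, up to the
factor `a ^ (-n)`. -/
noncomputable def awSum (q : ℂ) (n : ℕ) (u a b c d : ℂ) : ℂ :=
  ∑ k ∈ range (n + 1), awCoeff q n (a * b * c * d) k *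
    (qpoch (a * b * q ^ k) q (n - k) * qpoch (a * c * q ^ k) q (n - k) *
      qpoch (a * d * q ^ k) q (n - k)) * (qpoch (a * u) q k * qpoch (a / u) q k)

theorem askeyWilson_eq_awSum {q : ℂ} (hq : q ≠ 0) (n : ℕ) (u a b c d : ℂ)
    (hb : ∀ k ≤ n, qpoch (a * b) q k ≠ 0) (hc : ∀ k ≤ n, qpoch (a * c) q k ≠ 0)
    (hd : ∀ k ≤ n, qpoch (a * d) q k ≠ 0) :
    askeyWilson q n u a b c d = (a ^ n)⁻¹ * awSum q n u a b c d := by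
  simp only [askeyWilson, awSum, awCoeff, mul_assoc, zpow_neg, zpow_natCast]
  congr 1
  simp only [mul_sum]
  refine sum_congr rfl fun k hk => ?_
  have hkn : k ≤ n := Nat.lt_succ_iff.mp (mem_range.mp hk)
  have split (x : ℂ) : qpoch x q n = qpoch x q k * qpoch (x * q ^ k) q (n - k) := by
    rw [← qpoch_add, Nat.add_sub_cancel' hkn]
  have hpow : q ^ ((n : ℤ) - 1) = q ^ n / q := by
    rw [zpow_sub₀ hq, zpow_natCast, zpow_one]
  rw [split (a * b), split (a * c), split (a * d), hpow]
  have h1 := hb k hkn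
  have h2 := hc k hkn
  have h3 := hd k hkn
  simp only [← mul_assoc, mul_div_assoc]
  field_simp

theorem awCoeff_zero (q : ℂ) (n : ℕ) (e : ℂ) : awCoeff q n e 0 = 1 := by
  simp [awCoeff, qpoch_zero]

theorem awCoeff_self_succ {q : ℂ} (hq : q ≠ 0) (n : ℕ) (e : ℂ) :
    awCoeff q n e (n + 1) = 0 := by
  rw [awCoeff, qpoch_eq_zero (Nat.lt_succ_self n) (inv_mul_cancel₀ (pow_ne_zero n hq))]
  simp

theorem awCoeff_succ_succ {q : ℂ} (hq : q ≠ 0) (n : ℕ) (e : ℂ) (k : ℕ)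
    (hk : qpoch q q (k + 1) ≠ 0) :
    awCoeff q (n + 1) e (k + 1) =
      awCoeff q n (e * q ^ 2) (k + 1) * (q ^ (k + 1))⁻¹ -
        awCoeff q n (e * q ^ 2) k * ((q ^ k)⁻¹ * (1 - e * q ^ k)) := by
  have h1 : (q ^ (n + 1))⁻¹ * q = (q ^ n)⁻¹ := by
    rw [pow_succ]
    field_simp
  have h2 : e * q ^ (n + 1) / q = e * q ^ n := by
    rw [pow_succ]
    field_simp
  have h3 : e * q ^ 2 * q ^ n / q = e * q ^ n * q := by field_simp
  simp only [awCoeff, h2, h3]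
  rw [qpoch_succ' (q ^ (n + 1))⁻¹, h1, qpoch_succ' (e * q ^ n), qpoch_succ (q ^ n)⁻¹,
    qpoch_succ (e * q ^ n * q)]
  rw [qpoch_succ] at hk ⊢
  obtain ⟨hk1, hk2⟩ := mul_ne_zero_iff.mp hk
  have hk3 : 1 - q ^ (k + 1) ≠ 0 := by rwa [pow_succ']
  rw [← pow_succ']
  field_simp
  ring

/-- The raising operator applied to one summand. -/
theorem raising_term {q u : ℂ} (hq : q ≠ 0) (hu : u ≠ 0) (a b c d : ℂ) (k : ℕ) :
    -a * ((1 - a * u) * (1 - b * u) * (1 - c * u) * (1 - d * u) / u ^ 2 *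
          (qpoch (a * u * q) q k * qpoch (a / u) q k) -
        (1 - a / u) * (1 - b / u) * (1 - c / u) * (1 - d / u) * u ^ 2 *
          (qpoch (a * u) q k * qpoch (a / u * q) q k)) =
      (u - 1 / u) *
        ((q ^ k)⁻¹ * ((1 - a * b * q ^ k) * (1 - a * c * q ^ k) * (1 - a * d * q ^ k)) *
            (qpoch (a * u) q k * qpoch (a / u) q k) -
          (q ^ k)⁻¹ * (1 - a * b * c * d * q ^ k) *
            (qpoch (a * u) q (k + 1) * qpoch (a / u) q (k + 1))) := by
  have h1 := (qpoch_succ' (a * u) q k).symm.trans (qpoch_succ (a * u) q k)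
  have h2 := (qpoch_succ' (a / u) q k).symm.trans (qpoch_succ (a / u) q k)
  have hqk : q ^ k ≠ 0 := pow_ne_zero k hq
  rw [qpoch_succ, qpoch_succ]
  trans -a * ((1 - b * u) * (1 - c * u) * (1 - d * u) / u ^ 2 *
          (((1 - a * u) * qpoch (a * u * q) q k) * qpoch (a / u) q k) -
        (1 - b / u) * (1 - c / u) * (1 - d / u) * u ^ 2 *
          (qpoch (a * u) q k * ((1 - a / u) * qpoch (a / u * q) q k)))
  · ring
  rw [h1, h2]
  generalize qpoch (a * u) q k = X
  generalize qpoch (a / u) q k = Y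
  generalize q ^ k = w at *
  field_simp
  ring

/-- The raising (backward shift) relation for Askey–Wilson sums. -/
theorem awSum_raising {p u : ℂ} (hp : p ≠ 0) (hu : u ≠ 0) (n : ℕ) (a b c d : ℂ)
    (hqq : ∀ k ≤ n + 1, qpoch (p ^ 2) (p ^ 2) k ≠ 0) :
    (u - 1 / u) * awSum (p ^ 2) (n + 1) u a b c d =
      -a * ((1 - a * u) * (1 - b * u) * (1 - c * u) * (1 - d * u) / u ^ 2 *
          awSum (p ^ 2) n (u * p) (a * p) (b * p) (c * p) (d * p) -
        (1 - a / u) * (1 - b / u) * (1 - c / u) * (1 - d / u) * u ^ 2 *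
          awSum (p ^ 2) n (u / p) (a * p) (b * p) (c * p) (d * p)) := by
  have hq : p ^ 2 ≠ 0 := pow_ne_zero 2 hp
  have e1 : a * p * (u * p) = a * u * p ^ 2 := by ring
  have e2 : a * p / (u * p) = a / u := by field_simp
  have e3 : a * p * (u / p) = a * u := by field_simp
  have e4 : a * p / (u / p) = a / u * p ^ 2 := by field_simp
  have e5 : a * p * (b * p) * (c * p) * (d * p) = a * b * c * d * (p ^ 2) ^ 2 := by ring
  have e6 (x : ℂ) (k : ℕ) : a * p * (x * p) * (p ^ 2) ^ k = a * x * (p ^ 2) ^ (k + 1) := by ring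
  simp only [awSum, e1, e2, e3, e4, e5, e6]
  generalize p ^ 2 = q at *
  set G : ℕ → ℂ := fun k => qpoch (a * b * q ^ k) q (n + 1 - k) *
    qpoch (a * c * q ^ k) q (n + 1 - k) * qpoch (a * d * q ^ k) q (n + 1 - k) with hG
  have hGsucc (k : ℕ) : qpoch (a * b * q ^ (k + 1)) q (n - k) *
      qpoch (a * c * q ^ (k + 1)) q (n - k) * qpoch (a * d * q ^ (k + 1)) q (n - k) =
      G (k + 1) := by
    simp only [hG, Nat.add_sub_add_right]
  have hGstep (k : ℕ) (hk : k ≤ n) :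
      G k = (1 - a * b * q ^ k) * (1 - a * c * q ^ k) * (1 - a * d * q ^ k) * G (k + 1) := by
    simp only [hG, Nat.add_sub_add_right, Nat.sub_add_comm hk, qpoch_succ' _ q (n - k), pow_succ,
      ← mul_assoc]
    ring
  set C : ℕ → ℂ := awCoeff q n (a * b * c * d * q ^ 2) with hC
  set F : ℕ → ℂ := fun k => qpoch (a * u) q k * qpoch (a / u) q k with hF
  have lhs : ∑ k ∈ range (n + 1 + 1), awCoeff q (n + 1) (a * b * c * d) k * G k * F k =
      ∑ k ∈ range (n + 1), (C k * (q ^ k)⁻¹ * G k * F k -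
        C k * ((q ^ k)⁻¹ * (1 - a * b * c * d * q ^ k)) * G (k + 1) * F (k + 1)) := by
    have htop : ∑ k ∈ range (n + 1), C k * (q ^ k)⁻¹ * G k * F k =
        ∑ k ∈ range (n + 1 + 1), C k * (q ^ k)⁻¹ * G k * F k := by
      rw [sum_range_succ _ (n + 1), hC, awCoeff_self_succ hq]
      ring
    rw [sum_sub_distrib, htop, sum_range_succ', sum_range_succ' _ (n + 1), add_sub_right_comm,
      ← sum_sub_distrib]
    congr 1
    · refine sum_congr rfl fun k hk => ?_
      rw [awCoeff_succ_succ hq n _ k (hqq _ (by have := mem_range.mp hk; lia))]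
      ring
    · simp [hC, awCoeff_zero]
  rw [lhs]
  simp only [mul_sum]
  rw [← sum_sub_distrib, mul_sum]
  refine sum_congr rfl fun k hk => ?_
  rw [hGsucc, hGstep k (Nat.lt_succ_iff.mp (mem_range.mp hk))]
  linear_combination (-(C k * G (k + 1))) * raising_term hq hu a b c d k

theorem continuousOn_awSum (q : ℂ) (n : ℕ) (a b c d : ℂ) :
    ContinuousOn (fun u => awSum q n u a b c d) {0}ᶜ := by
  simp only [awSum, qpoch]
  have h : ∀ x ∈ ({0}ᶜ : Set ℂ), x ≠ 0 := fun x hx => hx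
  fun_prop (disch := assumption)

theorem eq_of_eq_off_unit_squares {f g : ℂ → ℂ} (hf : ContinuousOn f {0}ᶜ)
    (hg : ContinuousOn g {0}ᶜ) (h : ∀ u, u ≠ 0 → u - 1 / u ≠ 0 → f u = g u) {u : ℂ}
    (hu : u ≠ 0) : f u = g u := by
  have hmem : ({0}ᶜ : Set ℂ) ∈ nhds u := isOpen_compl_singleton.mem_nhds hu
  have hdense : Dense ({0, 1, -1}ᶜ : Set ℂ) :=
    (Set.toFinite ({0, 1, -1} : Set ℂ)).countable.dense_compl ℂ
  have hne : (nhdsWithin u ({0, 1, -1}ᶜ : Set ℂ)).NeBot :=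
    mem_closure_iff_nhdsWithin_neBot.mp (hdense u)
  have hlf := ((hf u hu).continuousAt hmem).tendsto.mono_left
    (nhdsWithin_le_nhds (s := ({0, 1, -1}ᶜ : Set ℂ)))
  have hlg := ((hg u hu).continuousAt hmem).tendsto.mono_left
    (nhdsWithin_le_nhds (s := ({0, 1, -1}ᶜ : Set ℂ)))
  refine tendsto_nhds_unique hlf (hlg.congr' ?_)
  filter_upwards [self_mem_nhdsWithin] with v hv
  simp only [Set.mem_compl_iff, Set.mem_insert_iff, Set.mem_singleton_iff, not_or] at hv
  obtain ⟨h0, h1, h2⟩ := hv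
  refine (h v h0 fun hz => ?_).symm
  have hsq : v ^ 2 = 1 := by
    field_simp at hz
    linear_combination hz
  rcases sq_eq_one_iff.mp hsq with h | h
  exacts [h1 h, h2 h]

/-- Askey–Wilson polynomials are invariant under exchanging the first and last parameter. -/
theorem awSum_swap {p : ℂ} (hp : p ≠ 0) (n : ℕ) :
    ∀ (a b c d u : ℂ), a ≠ 0 → d ≠ 0 → u ≠ 0 →
      (∀ k ≤ n, qpoch (p ^ 2) (p ^ 2) k ≠ 0) →
      (a ^ n)⁻¹ * awSum (p ^ 2) n u a b c d = (d ^ n)⁻¹ * awSum (p ^ 2) n u d b c a := by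
  induction n with
  | zero => intros; simp [awSum, awCoeff, qpoch]
  | succ n ih =>
    intro a b c d u ha hd hu hqq
    refine eq_of_eq_off_unit_squares
      (f := fun u => (a ^ (n + 1))⁻¹ * awSum (p ^ 2) (n + 1) u a b c d)
      (g := fun u => (d ^ (n + 1))⁻¹ * awSum (p ^ 2) (n + 1) u d b c a)
      (continuousOn_const.mul (continuousOn_awSum _ _ _ _ _ _))
      (continuousOn_const.mul (continuousOn_awSum _ _ _ _ _ _)) (fun u hu hu' => ?_) hu
    have ih' (v : ℂ) (hv : v ≠ 0) := ih (a * p) (b * p) (c * p) (d * p) v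
      (mul_ne_zero ha hp) (mul_ne_zero hd hp) hv fun k hk => hqq k (by lia)
    have ih1 := ih' (u * p) (mul_ne_zero hu hp)
    have ih2 := ih' (u / p) (div_ne_zero hu hp)
    have r1 := awSum_raising hp hu n a b c d hqq
    have r2 := awSum_raising hp hu n d b c a hqq
    apply mul_left_cancel₀ hu'
    have s1 (x : ℂ) (hx : x ≠ 0) : (x ^ (n + 1))⁻¹ * -x = -p ^ n * ((x * p) ^ n)⁻¹ := by
      rw [mul_pow, pow_succ]
      field_simp
    calc _ = (a ^ (n + 1))⁻¹ * ((u - 1 / u) * awSum (p ^ 2) (n + 1) u a b c d) := by ring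
      _ = (d ^ (n + 1))⁻¹ * ((u - 1 / u) * awSum (p ^ 2) (n + 1) u d b c a) := by
        rw [r1, r2, ← mul_assoc, ← mul_assoc, s1 a ha, s1 d hd]
        linear_combination
          -p ^ n * ((1 - a * u) * (1 - b * u) * (1 - c * u) * (1 - d * u) / u ^ 2) * ih1 +
          p ^ n * ((1 - a / u) * (1 - b / u) * (1 - c / u) * (1 - d / u) * u ^ 2) * ih2
      _ = _ := by ring

theorem awSum_comm₂₃ (q : ℂ) (n : ℕ) (u a b c d : ℂ) :
    awSum q n u a b c d = awSum q n u a c b d := by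
  simp only [awSum]
  refine sum_congr rfl fun k _ => ?_
  rw [show a * b * c * d = a * c * b * d by ring]
  ring

theorem awSum_comm₃₄ (q : ℂ) (n : ℕ) (u a b c d : ℂ) :
    awSum q n u a b c d = awSum q n u a b d c := by
  simp only [awSum]
  refine sum_congr rfl fun k _ => ?_
  rw [show a * b * c * d = a * b * d * c by ring]
  ring

theorem qpoch_inv_pow {q : ℂ} (hq : q ≠ 0) (l m : ℕ) :
    qpoch (q ^ (l + m))⁻¹ q m * qpoch q q l * q ^ ((l + m) * m) =
      (-1) ^ m * q ^ m.choose 2 * qpoch q q (l + m) := by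
  induction m with
  | zero => simp [qpoch_zero]
  | succ m ih =>
    have h : (q ^ (l + (m + 1)))⁻¹ * q = (q ^ (l + m))⁻¹ := by
      rw [← add_assoc, pow_succ]; field_simp
    rw [qpoch_succ', h, ← add_assoc, qpoch_succ q, Nat.choose_succ_succ' m 1, Nat.choose_one_right]
    have e : q ^ ((l + m + 1) * (m + 1)) = q ^ ((l + m) * m) * q ^ m * q ^ (l + m + 1) := by
      rw [← pow_add, ← pow_add]; congr 1; ring
    rw [e]
    have hx : (q ^ (l + m + 1))⁻¹ * q ^ (l + m + 1) = 1 := inv_mul_cancel₀ (pow_ne_zero _ hq)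
    have hq' : q * q ^ (l + m) = q ^ (l + m + 1) := (pow_succ' _ _).symm
    rw [hq', pow_add q m]
    generalize q ^ (l + m + 1) = w at *
    linear_combination q ^ m * (w - 1) * ih - qpoch (q ^ (l + m))⁻¹ q m * qpoch q q l *
      q ^ ((l + m) * m) * q ^ m * hx

/-- If `cd = q ^ (1 - m)`, the leading `m` terms of the Askey–Wilson sum vanish and the rest is
a shifted Askey–Wilson sum of degree `n - m`. -/
theorem awSum_truncate {q d : ℂ} (hq : q ≠ 0) (hd : d ≠ 0) (l m : ℕ) (u a b c : ℂ)
    (hc : d * c * q ^ m = q) (hqq : ∀ k ≤ l + m, qpoch q q k ≠ 0) :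
    awSum q (l + m) u d a b c * q ^ ((l + m) * m) =
      (-1) ^ m * q ^ m.choose 2 * q ^ m * qpoch (a * b * q ^ l) q m *
        (qpoch (d * u) q m * qpoch (d / u) q m) * awSum q l u (q ^ m * d) a b (q / d) := by
  have hqm : q ^ m ≠ 0 := pow_ne_zero m hq
  simp only [awSum]
  rw [show l + m + 1 = m + (l + 1) by ring, sum_range_add, sum_eq_zero, zero_add, sum_mul, mul_sum]
  · refine sum_congr rfl fun j hj => ?_
    have hjl : j ≤ l := Nat.lt_succ_iff.mp (mem_range.mp hj)
    have f1 : (q ^ (l + m))⁻¹ * q ^ m = (q ^ l)⁻¹ := by rw [pow_add]; field_simp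
    have f2 : d * a * b * c * q ^ (l + m) / q = a * b * q ^ l := by
      rw [pow_add, div_eq_iff hq]; linear_combination a * b * q ^ l * hc
    have f3 : q ^ m * d * a * b * (q / d) * q ^ l / q = a * b * q ^ l * q ^ m := by field_simp
    have f4 : d * c * q ^ (m + j) = q * q ^ j := by
      rw [pow_add]; linear_combination q ^ j * hc
    have f5 : q ^ m * d * (q / d) = q * q ^ m := by field_simp
    have f6 (x : ℂ) : d * x * q ^ (m + j) = q ^ m * d * x * q ^ j := by rw [pow_add]; ring
    have f7 : d * u * q ^ m = q ^ m * d * u := by ring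
    have f8 : d / u * q ^ m = q ^ m * d / u := by ring
    have g1 : qpoch q q l = qpoch q q j * qpoch (q * q ^ j) q (l - j) := by
      rw [← qpoch_add, Nat.add_sub_cancel' hjl]
    have g2 : qpoch (q * q ^ m) q l =
        qpoch (q * q ^ m) q j * qpoch (q * q ^ m * q ^ j) q (l - j) := by
      rw [← qpoch_add, Nat.add_sub_cancel' hjl]
    have g3 : qpoch q q (l + m) = qpoch q q m * qpoch (q * q ^ m) q l := by
      rw [add_comm, qpoch_add]
    have key := qpoch_inv_pow hq l m
    have hj0 := hqq j (by lia)
    have hmj := hqq (m + j) (by lia)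
    rw [qpoch_add] at hmj
    obtain ⟨hm0, hmj0⟩ := mul_ne_zero_iff.mp hmj
    have hsub : l + m - (m + j) = l - j := by lia
    simp only [awCoeff]
    rw [f2, f3, f4, f5, f6, f6, hsub]
    simp only [qpoch_add _ q m j, f1, f7, f8]
    rw [g3, g1, g2] at key
    rw [pow_add q m j]
    generalize q ^ ((l + m) * m) = w at *
    generalize q ^ m.choose 2 = z at *
    generalize qpoch (q * q ^ m * q ^ j) q (l - j) = y1 at *
    generalize qpoch (q * q ^ j) q (l - j) = y2 at *
    generalize qpoch (q ^ (l + m))⁻¹ q m = y3 at *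
    generalize qpoch (q * q ^ m) q j = y4 at *
    generalize qpoch q q j = y5 at *
    generalize qpoch q q m = y6 at *
    generalize qpoch (q ^ l)⁻¹ q j = y7 at *
    have key' : y3 * y2 * w / (y6 * y4) = (-1) ^ m * z * y1 / y5 := by
      rw [div_eq_div_iff hmj hj0]; linear_combination key
    linear_combination y7 * qpoch (a * b * q ^ l) q m * qpoch (a * b * q ^ l * q ^ m) q j *
      q ^ m * q ^ j * qpoch (q ^ m * d * a * q ^ j) q (l - j) *
      qpoch (q ^ m * d * b * q ^ j) q (l - j) * qpoch (d * u) q m * qpoch (d / u) q m *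
      qpoch (q ^ m * d * u) q j * qpoch (q ^ m * d / u) q j * key'
  · intro k hk
    have hkm := mem_range.mp hk
    have hz : qpoch (d * c * q ^ k) q (l + m - k) = 0 := by
      refine qpoch_eq_zero (i := m - 1 - k) (by lia) (mul_right_cancel₀ hq ?_)
      rw [one_mul, mul_assoc, mul_assoc, ← pow_succ, ← pow_add,
        show k + (m - 1 - k + 1) = m by lia, hc]
    rw [hz]
    ring

theorem askey_wilson_partial_factorization (n m : ℕ) (hmn : m ≤ n)
    (q t1 t2 t4 u : ℂ)
    (hq : q ≠ 0) (ht1 : t1 ≠ 0) (ht2 : t2 ≠ 0) (ht4 : t4 ≠ 0) (hu : u ≠ 0)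
    (hqq : ∀ k : ℕ, k ≤ n → qpoch q q k ≠ 0)
    (h12 : ∀ k : ℕ, k ≤ n → qpoch (t1 * t2) q k ≠ 0)
    (h14 : ∀ k : ℕ, k ≤ n → qpoch (t1 * t4) q k ≠ 0)
    (h13 : ∀ k : ℕ, k ≤ n → qpoch (q ^ (1 - (m : ℤ)) * t1 / t4) q k ≠ 0)
    (h21 : ∀ k : ℕ, k ≤ n - m → qpoch (t2 * t1) q k ≠ 0)
    (h23 : ∀ k : ℕ, k ≤ n - m → qpoch (t2 * q / t4) q k ≠ 0)
    (h24 : ∀ k : ℕ, k ≤ n - m → qpoch (q ^ m * t2 * t4) q k ≠ 0) :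
    qpoch (t1 * t2) q (n - m) * askeyWilson q n u t1 t2 (q ^ (1 - (m : ℤ)) / t4) t4
      = (-1 : ℂ) ^ m * t4 ^ (-(m : ℤ)) * q ^ (-(m.choose 2 : ℤ)) *
          qpoch (t4 * u) q m * qpoch (t4 / u) q m * qpoch (t1 * t2) q n *
          askeyWilson q (n - m) u t2 t1 (q / t4) (q ^ m * t4) := by
  obtain ⟨l, rfl⟩ := Nat.exists_eq_add_of_le' hmn
  rw [Nat.add_sub_cancel] at *
  obtain ⟨p, hp2⟩ : ∃ p : ℂ, p ^ 2 = q := IsAlgClosed.exists_pow_nat_eq q two_pos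
  have hp : p ≠ 0 := by rintro rfl; exact hq (by simpa using hp2.symm)
  have hqm : q ^ m ≠ 0 := pow_ne_zero m hq
  have hz : q ^ (1 - (m : ℤ)) = q / q ^ m := by rw [zpow_sub₀ hq, zpow_one, zpow_natCast]
  rw [hz] at h13 ⊢
  have swap₁ := awSum_swap hp (l + m) t1 t2 (q / q ^ m / t4) t4 u ht1 ht4 hu (by rwa [hp2])
  have swap₂ := awSum_swap hp l t2 t1 (q / t4) (q ^ m * t4) u ht2 (mul_ne_zero hqm ht4) hu
    (by rw [hp2]; exact fun k hk => hqq k (by lia))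
  rw [hp2] at swap₁ swap₂
  rw [askeyWilson_eq_awSum hq _ _ _ _ _ _ h12
      (fun k hk => by convert h13 k hk using 2; ring) h14, swap₁,
    askeyWilson_eq_awSum hq _ _ _ _ _ _ h21
      (fun k hk => by convert h23 k hk using 2; ring)
      (fun k hk => by convert h24 k hk using 2; ring), swap₂]
  have trunc := awSum_truncate hq ht4 l m u t2 t1 (q / q ^ m / t4) (by field_simp) hqq
  rw [awSum_comm₃₄ q (l + m), awSum_comm₃₄ q l, awSum_comm₂₃ q l]
  have hsq : q ^ ((l + m) * m) = (q ^ m) ^ l * (q ^ m.choose 2 * q ^ m.choose 2 * q ^ m) := by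
    simp only [← pow_mul, ← pow_add]
    congr 1
    rcases m with _ | m
    · simp
    · rw [Nat.choose_two_right, ← two_mul, Nat.mul_div_cancel' (Nat.even_mul_pred_self _).two_dvd,
        Nat.add_sub_cancel]
      ring
  rw [hsq, mul_comm t2 t1] at trunc
  simp only [zpow_neg, zpow_natCast]
  rw [qpoch_add (t1 * t2)]
  have hC : q ^ m.choose 2 ≠ 0 := pow_ne_zero _ hq
  generalize awSum q (l + m) u t4 t2 t1 (q / q ^ m / t4) = S at *
  generalize awSum q l u (q ^ m * t4) t2 t1 (q / t4) = T at *
  generalize q ^ m.choose 2 = z at *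
  generalize q ^ m = w at *
  have trunc' : S * w ^ l * z = (-1) ^ m * qpoch (t1 * t2 * q ^ l) q m *
      (qpoch (t4 * u) q m * qpoch (t4 / u) q m) * T := by
    apply mul_right_cancel₀ (mul_ne_zero hC hqm)
    linear_combination trunc
  rw [mul_pow, pow_add]
  generalize qpoch (t1 * t2 * q ^ l) q m = X at *
  generalize qpoch (t1 * t2) q l = X1 at *
  generalize qpoch (t4 * u) q m = X2 at *
  generalize qpoch (t4 / u) q m = X3 at *
  field_simp
  linear_combination X1 * trunc'
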